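/- (Theorem 3.3) Assume each ℓ_i is convex and G_i-Lipschitz and f has a minimizer x_*. Run shuffled SGD for K epochs (with arbitrary, possibly uniformly random, permutations π^{(k)}) with step sizes η_k, and let H_K = ∑η_k, x̂_K = (∑η_k x_k)/H_K, Ḡ = E_π[√(Ĝ_π G̃_π)] (expectation over the permutation distribution used; for deterministic ordering Ḡ = √(Ĝ₀G̃₀)). Then E[H_K (f(x̂_K) − f(x_*))] ≤ (b/(2n))‖x_0 − x_*‖₂² + ∑_{k=1}^K 2η_k² n Ḡ / b. -/

import Mathlib

open Finset Matrix

namespace SSGD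

/-- squared Euclidean norm of a finite vector -/
noncomputable def sq {ι : Type*} [Fintype ι] (x : ι → ℝ) : ℝ := ∑ i, (x i) ^ 2

/-- Euclidean dot product -/
noncomputable def dot {ι : Type*} [Fintype ι] (x y : ι → ℝ) : ℝ := ∑ i, x i * y i

/-- weighted squared norm `‖u‖²_{(diag w)⁻¹} = ∑ i, (u i)² / w i` -/
noncomputable def wsq {ι : Type*} [Fintype ι] (w u : ι → ℝ) : ℝ := ∑ i, (u i) ^ 2 / w i

/-- operator (spectral) norm of a real matrix -/
noncomputable def opNorm {α β : Type*} [Fintype α] [Fintype β] [DecidableEq β]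
    (M : Matrix α β ℝ) : ℝ :=
  ‖LinearMap.toContinuousLinearMap (Matrix.toEuclideanLin M)‖

/-- `0`-based global index of the `j`-th element of the `i`-th batch of size `b` -/
def idx (b m : ℕ) (i : Fin m) (j : Fin b) : Fin (b * m) :=
  ⟨b * i.1 + j.1, by
    have hi : i.1 + 1 ≤ m := i.2
    have hj : j.1 < b := j.2
    calc b * i.1 + j.1 < b * i.1 + b := by omega
      _ = b * (i.1 + 1) := by ring
      _ ≤ b * m := Nat.mul_le_mul (le_refl b) hi⟩

/-- `I_{j↑}` : the identity matrix with its first `j` diagonal entries zeroed out -/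
noncomputable def Iup (n j : ℕ) : Matrix (Fin n) (Fin n) ℝ :=
  Matrix.diagonal fun i => if j ≤ i.1 then 1 else 0

/-- `I_{(j)}` (`j` 0-based) : diagonal matrix with ones exactly in positions
`b*j, …, b*(j+1)-1` -/
noncomputable def Iblk (n b j : ℕ) : Matrix (Fin n) (Fin n) ℝ :=
  Matrix.diagonal fun i => if b * j ≤ i.1 ∧ i.1 < b * (j + 1) then 1 else 0

variable {d b m : ℕ}

/-- the row-permuted data matrix `A_π` (row `i` of `A_π` is row `π i` of `A`) -/
def permMat (A : Matrix (Fin (b * m)) (Fin d) ℝ) (π : Equiv.Perm (Fin (b * m))) :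
    Matrix (Fin (b * m)) (Fin d) ℝ :=
  A.submatrix π id

/-- `Ĉ_π = (1/(m·n)) ‖W_π^{1/2} (∑_{j=1}^m I_{b(j-1)↑} A_π A_πᵀ I_{b(j-1)↑}) W_π^{1/2}‖₂`;
this is `L̂_π` for `w = L` and `Ĝ_π` for `w = G²`. -/
noncomputable def hatC (A : Matrix (Fin (b * m)) (Fin d) ℝ) (w : Fin (b * m) → ℝ)
    (π : Equiv.Perm (Fin (b * m))) : ℝ :=
  (1 / ((m : ℝ) * ((b * m : ℕ) : ℝ))) * opNorm
    (Matrix.diagonal (fun i => Real.sqrt (w (π i))) *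
      (∑ j : Fin m,
        Iup (b * m) (b * j.1) * (permMat A π * (permMat A π)ᵀ) * Iup (b * m) (b * j.1)) *
      Matrix.diagonal (fun i => Real.sqrt (w (π i))))

/-- `C̃_π = (1/b) ‖W_π^{1/2} (∑_{j=1}^m I_{(j)} A_π A_πᵀ I_{(j)}) W_π^{1/2}‖₂`;
this is `L̃_π` for `w = L` and `G̃_π` for `w = G²`. -/
noncomputable def tilC (A : Matrix (Fin (b * m)) (Fin d) ℝ) (w : Fin (b * m) → ℝ)
    (π : Equiv.Perm (Fin (b * m))) : ℝ :=
  (1 / (b : ℝ)) * opNorm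
    (Matrix.diagonal (fun i => Real.sqrt (w (π i))) *
      (∑ j : Fin m,
        Iblk (b * m) b j.1 * (permMat A π * (permMat A π)ᵀ) * Iblk (b * m) b j.1) *
      Matrix.diagonal (fun i => Real.sqrt (w (π i))))

/-- one inner (mini-batch) step of shuffled SGD, using the (sub)gradient selection `g` -/
noncomputable def step (A : Matrix (Fin (b * m)) (Fin d) ℝ) (g : Fin (b * m) → ℝ → ℝ)
    (η : ℝ) (π : Equiv.Perm (Fin (b * m))) (i : Fin m) (x : Fin d → ℝ) : Fin d → ℝ :=
  fun t => x t - (η / (b : ℝ)) *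
    ∑ j : Fin b, g (π (idx b m i j)) (dot (A (π (idx b m i j))) x) * A (π (idx b m i j)) t

/-- the primal iterates `x_{k-1,1}, …, x_{k-1,m+1}` within a single epoch
(`inIter A g η π x0 i` is `x_{k-1,i+1}`, so `inIter … 0 = x_{k-1}` and
`inIter … m = x_k`) -/
noncomputable def inIter (A : Matrix (Fin (b * m)) (Fin d) ℝ) (g : Fin (b * m) → ℝ → ℝ)
    (η : ℝ) (π : Equiv.Perm (Fin (b * m))) (x0 : Fin d → ℝ) : ℕ → Fin d → ℝ
  | 0 => x0
  | i + 1 =>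
    if h : i < m then step A g η π ⟨i, h⟩ (inIter A g η π x0 i) else inIter A g η π x0 i

/-- the dual vector `y_k` of one epoch, in permuted coordinates: its `p`-th entry is
`g_{π(p)}(a_{π(p)}ᵀ x_{k-1,i})` where `i` is the batch containing position `p` -/
noncomputable def dualY (A : Matrix (Fin (b * m)) (Fin d) ℝ) (g : Fin (b * m) → ℝ → ℝ)
    (η : ℝ) (π : Equiv.Perm (Fin (b * m))) (x0 : Fin d → ℝ) : Fin (b * m) → ℝ :=
  fun p => g (π p) (dot (A (π p)) (inIter A g η π x0 (p.1 / b)))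

/-- multi-epoch shuffled SGD: `xSeq A g η πs x0 k` is the iterate after `k` full epochs;
the (0-based) epoch `k` uses the permutation `πs k` and the step size `η k`. -/
noncomputable def xSeq (A : Matrix (Fin (b * m)) (Fin d) ℝ) (g : Fin (b * m) → ℝ → ℝ)
    (η : ℕ → ℝ) (πs : ℕ → Equiv.Perm (Fin (b * m))) (x0 : Fin d → ℝ) : ℕ → Fin d → ℝ
  | 0 => x0
  | k + 1 => inIter A g (η k) (πs k) (xSeq A g η πs x0 k) m

/-- the convex (Fenchel) conjugate of `f : ℝ → ℝ` -/
noncomputable def fconj (f : ℝ → ℝ) (y : ℝ) : ℝ := sSup (Set.range fun t => y * t - f t)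

/-- the Lagrangian `𝓛(x,y) = (1/n) ⟨A x, y⟩ - (1/n) ∑ᵢ ℓᵢ*(yⁱ)` -/
noncomputable def Lagr (A : Matrix (Fin (b * m)) (Fin d) ℝ) (ℓ : Fin (b * m) → ℝ → ℝ)
    (x : Fin d → ℝ) (y : Fin (b * m) → ℝ) : ℝ :=
  (1 / ((b * m : ℕ) : ℝ)) * ∑ i, dot (A i) x * y i
    - (1 / ((b * m : ℕ) : ℝ)) * ∑ i, fconj (ℓ i) (y i)

/-- `g` is a (global) subgradient of `f` at `t` -/
def IsSubgrad (f : ℝ → ℝ) (t g : ℝ) : Prop := ∀ s, f t + g * (s - t) ≤ f s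

/-- expectation with respect to the uniform distribution on a finite type -/
noncomputable def Eunif {α : Type*} [Fintype α] (F : α → ℝ) : ℝ :=
  (∑ a : α, F a) / (Fintype.card α : ℝ)

/-- extend a `K`-tuple of permutations to an `ℕ`-indexed sequence (by the identity) -/
def extSeq {K n : ℕ} (g : Fin K → Equiv.Perm (Fin n)) : ℕ → Equiv.Perm (Fin n) :=
  fun k => if h : k < K then g ⟨k, h⟩ else 1

/-- A matrix is bounded as a quadratic form by its operator norm. -/
lemma dotProduct_mulVec_le_opNorm {N : Type*} [Fintype N] [DecidableEq N]
    (M : Matrix N N ℝ) (v : N → ℝ) : v ⬝ᵥ (M *ᵥ v) ≤ opNorm M * sq v := by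
  have hsq : sq v = ‖WithLp.toLp 2 v‖ ^ 2 := by
    simp [EuclideanSpace.norm_sq_eq, sq]
  have hin : v ⬝ᵥ (M *ᵥ v) =
      inner ℝ (WithLp.toLp 2 v) (Matrix.toEuclideanLin M (WithLp.toLp 2 v)) := by
    simp [PiLp.inner_apply, dotProduct, Matrix.toLpLin_apply, mul_comm]
  rw [hsq, hin]
  refine (real_inner_le_norm _ _).trans ?_
  have h := (LinearMap.toContinuousLinearMap (Matrix.toEuclideanLin M)).le_opNorm
    (WithLp.toLp 2 v)
  rw [LinearMap.coe_toContinuousLinearMap'] at h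
  unfold opNorm
  nlinarith [norm_nonneg (WithLp.toLp 2 v)]

/-- A sum of squared norms of masked row combinations is bounded by the operator norm of the
corresponding weighted Gram matrix. -/
lemma sum_sq_mask_le {ι N D : Type*} [Fintype ι] [Fintype N] [DecidableEq N] [Fintype D]
    (B : Matrix N D ℝ) (s : N → ℝ) (J : ι → N → ℝ) (v : N → ℝ) :
    ∑ j, sq (fun t => ∑ p, J j p * (s p * v p) * B p t) ≤
      opNorm (Matrix.diagonal s *
        (∑ j, Matrix.diagonal (J j) * (B * Bᵀ) * Matrix.diagonal (J j)) *
        Matrix.diagonal s) * sq v := by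
  refine le_of_eq_of_le ?_ (dotProduct_mulVec_le_opNorm _ v)
  have hterm : ∀ j, v ⬝ᵥ ((Matrix.diagonal s *
      (Matrix.diagonal (J j) * (B * Bᵀ) * Matrix.diagonal (J j)) * Matrix.diagonal s) *ᵥ v)
      = sq (fun t => ∑ p, J j p * (s p * v p) * B p t) := by
    intro j
    set C : Matrix D N ℝ := Bᵀ * Matrix.diagonal (J j) * Matrix.diagonal s with hC
    have hM : Matrix.diagonal s *
        (Matrix.diagonal (J j) * (B * Bᵀ) * Matrix.diagonal (J j)) * Matrix.diagonal s
        = Cᵀ * C := by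
      simp only [hC, Matrix.transpose_mul, Matrix.diagonal_transpose, Matrix.transpose_transpose,
        Matrix.mul_assoc]
    have hCv : C *ᵥ v = fun t => ∑ p, J j p * (s p * v p) * B p t := by
      funext t
      simp only [hC, Matrix.mulVec, dotProduct, Matrix.mul_diagonal, Matrix.transpose_apply]
      exact Finset.sum_congr rfl fun p _ => by ring
    rw [hM, ← Matrix.mulVec_mulVec, Matrix.dotProduct_mulVec, Matrix.vecMul_transpose, hCv]
    simp [sq, dotProduct, pow_two]
  simp only [Matrix.mul_sum, Matrix.sum_mul, Matrix.sum_mulVec, dotProduct_sum, hterm]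

lemma abs_le_of_isSubgrad {f : ℝ → ℝ} {L t y : ℝ} (hL : ∀ s t, |f s - f t| ≤ L * |s - t|)
    (h : IsSubgrad f t y) : |y| ≤ L := by
  have h1 := h (t + 1)
  have h2 := h (t - 1)
  have h3 := (abs_le.mp (hL (t + 1) t)).2
  have h4 := (abs_le.mp (hL (t - 1) t)).2
  norm_num at h1 h2 h3 h4
  exact abs_le.mpr ⟨by linarith, by linarith⟩

lemma sum_idx (i : Fin m) (F : Fin (b * m) → ℝ) :
    ∑ j : Fin b, F (idx b m i j) =
      ∑ p, (if b * i.1 ≤ p.1 ∧ p.1 < b * (i.1 + 1) then 1 else 0) * F p := by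
  simp only [ite_mul, one_mul, zero_mul]
  rw [← Finset.sum_filter]
  refine Finset.sum_bij (fun j _ => idx b m i j) ?_ ?_ ?_ ?_
  · intro j _
    have := j.2
    simp only [idx, Finset.mem_filter, Finset.mem_univ, true_and, mul_add]
    omega
  · intro j _ j' _ h
    simp only [idx, Fin.mk.injEq] at h
    exact Fin.ext (by omega)
  · intro p hp
    simp only [Finset.mem_filter, Finset.mem_univ, true_and, mul_add] at hp
    exact ⟨⟨p.1 - b * i.1, by omega⟩, Finset.mem_univ _, Fin.ext (by simp only [idx]; omega)⟩
  · intros; rfl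

lemma inIter_apply (hb : 0 < b) (A : Matrix (Fin (b * m)) (Fin d) ℝ)
    (g : Fin (b * m) → ℝ → ℝ) (η : ℝ) (π : Equiv.Perm (Fin (b * m))) (x : Fin d → ℝ)
    (t : Fin d) {i : ℕ} (hi : i ≤ m) :
    inIter A g η π x i t = x t - (η / b) *
      ∑ p : Fin (b * m), (if p.1 < b * i then 1 else 0) * (dualY A g η π x p * A (π p) t) := by
  induction i with
  | zero => simp [inIter]
  | succ i ih =>
    have him : i < m := hi
    have hstep : inIter A g η π x (i + 1) t = inIter A g η π x i t - (η / b) *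
        ∑ p : Fin (b * m), (if b * i ≤ p.1 ∧ p.1 < b * (i + 1) then 1 else 0) *
          (dualY A g η π x p * A (π p) t) := by
      rw [inIter, dif_pos him, step, ← sum_idx ⟨i, him⟩]
      congr 2
      refine Finset.sum_congr rfl fun j _ => ?_
      have : (idx b m ⟨i, him⟩ j).1 / b = i := by
        simp [idx, Nat.mul_add_div hb, Nat.div_eq_of_lt j.2]
      rw [dualY, this]
    rw [hstep, ih him.le, sub_sub, ← mul_add, ← Finset.sum_add_distrib]
    congr 2
    refine Finset.sum_congr rfl fun p _ => ?_
    rw [← add_mul]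
    congr 1
    have : b * (i + 1) = b * i + b := by ring
    split_ifs <;> first | omega | norm_num

lemma dot_sum_right {ι κ : Type*} [Fintype ι] (s : Finset κ) (a : ι → ℝ) (c : κ → ℝ)
    (v : κ → ι → ℝ) :
    dot a (fun t => ∑ k ∈ s, c k * v k t) = ∑ k ∈ s, c k * dot a (v k) := by
  simp only [dot, Finset.mul_sum]
  rw [Finset.sum_comm]
  exact Finset.sum_congr rfl fun k _ => Finset.sum_congr rfl fun t _ => by ring

lemma dot_sub_right {ι : Type*} [Fintype ι] (a x y : ι → ℝ) :
    dot a (fun t => x t - y t) = dot a x - dot a y := by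
  simp [dot, mul_sub]

lemma sum_dot_le_sqrt_mul_sqrt {ι κ : Type*} [Fintype ι] [Fintype κ] (U V : κ → ι → ℝ) :
    ∑ k, dot (U k) (V k) ≤ √(∑ k, sq (U k)) * √(∑ k, sq (V k)) := by
  have h := Real.sum_mul_le_sqrt_mul_sqrt Finset.univ
    (fun q : κ × ι => U q.1 q.2) (fun q => V q.1 q.2)
  simpa only [Fintype.sum_prod_type, dot, sq] using h

lemma sum_sq_mask_le_of_abs_le (A : Matrix (Fin (b * m)) (Fin d) ℝ) (G : Fin (b * m) → ℝ)
    (hG : ∀ i, 0 < G i) (π : Equiv.Perm (Fin (b * m))) (J : Fin m → Fin (b * m) → ℝ)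
    (u : Fin (b * m) → ℝ) {c : ℝ} (hu : ∀ p, |u p| ≤ c * G (π p)) :
    ∑ j, sq (fun t => ∑ p, J j p * u p * A (π p) t) ≤
      opNorm (Matrix.diagonal (fun i => √(G (π i) ^ 2)) *
        (∑ j, Matrix.diagonal (J j) * (permMat A π * (permMat A π)ᵀ) * Matrix.diagonal (J j)) *
        Matrix.diagonal (fun i => √(G (π i) ^ 2))) * (c ^ 2 * ((b * m : ℕ) : ℝ)) := by
  have hs : ∀ p, √(G (π p) ^ 2) * (u p / G (π p)) = u p := fun p => by
    rw [Real.sqrt_sq (hG _).le, mul_div_cancel₀ _ (hG _).ne']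
  have h := sum_sq_mask_le (permMat A π) (fun i => √(G (π i) ^ 2)) J (fun p => u p / G (π p))
  simp only [hs] at h
  refine h.trans (mul_le_mul_of_nonneg_left ?_ (norm_nonneg _))
  calc sq (fun p => u p / G (π p)) ≤ ∑ _p : Fin (b * m), c ^ 2 := by
        refine Finset.sum_le_sum fun p _ => ?_
        have hc : |u p / G (π p)| ≤ c := by
          rw [abs_div, abs_of_pos (hG _), div_le_iff₀ (hG _)]
          exact hu p
        exact sq_le_sq' (abs_le.mp hc).1 (abs_le.mp hc).2
    _ = c ^ 2 * ((b * m : ℕ) : ℝ) := by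
        rw [Finset.sum_const, Finset.card_univ, Fintype.card_fin, nsmul_eq_mul, mul_comm]

/-- The error caused by evaluating subgradients at inner iterates instead of at the end of the
epoch. -/
lemma sum_mul_dot_drift_le (hb : 0 < b) (hm : 0 < m) (A : Matrix (Fin (b * m)) (Fin d) ℝ)
    (g : Fin (b * m) → ℝ → ℝ) (G : Fin (b * m) → ℝ) (hG : ∀ i, 0 < G i)
    (hgG : ∀ i t, |g i t| ≤ G i) {η : ℝ} (hη : 0 < η) (π : Equiv.Perm (Fin (b * m)))
    (x : Fin d → ℝ) (u : Fin (b * m) → ℝ) (hu : ∀ p, |u p| ≤ 2 * G (π p)) :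
    ∑ p : Fin (b * m), u p * (dot (A (π p)) (inIter A g η π x (p.1 / b))
        - dot (A (π p)) (inIter A g η π x m)) ≤
      (η / b) * (2 * ((b * m : ℕ) : ℝ) ^ 2 *
        √(hatC A (fun i => G i ^ 2) π * tilC A (fun i => G i ^ 2) π)) := by
  set y := dualY A g η π x with hy
  set X := inIter A g η π x with hX
  set P : Fin m → Fin (b * m) → ℝ :=
    fun j p => if b * j.1 ≤ p.1 ∧ p.1 < b * (j.1 + 1) then 1 else 0 with hP
  set Q : Fin m → Fin (b * m) → ℝ := fun j p => if b * j.1 ≤ p.1 then 1 else 0 with hQ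
  set U : Fin m → Fin d → ℝ := fun j t => ∑ p, P j p * u p * A (π p) t with hU
  set V : Fin m → Fin d → ℝ := fun j t => ∑ p, Q j p * y p * A (π p) t with hV
  have hXV : ∀ j : Fin m, (fun t => X j t - X m t) = fun t => (η / b) * V j t := by
    intro j
    funext t
    rw [hX, inIter_apply hb A g η π x t j.2.le, inIter_apply hb A g η π x t le_rfl,
      sub_sub_sub_cancel_left, ← mul_sub, ← Finset.sum_sub_distrib]
    congr 1
    refine Finset.sum_congr rfl fun p _ => ?_
    rw [← sub_mul, mul_assoc]
    congr 1
    simp only [hQ, p.2, if_true]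
    split_ifs <;> first | omega | norm_num
  have hblock : ∀ (p : Fin (b * m)) (F : ℕ → ℝ), F (p.1 / b) = ∑ j : Fin m, P j p * F j := by
    intro p F
    have hlt : p.1 / b < m := Nat.div_lt_of_lt_mul p.2
    rw [Finset.sum_eq_single (⟨p.1 / b, hlt⟩ : Fin m)]
    · have h1 := Nat.mul_div_le p.1 b
      have h2 := Nat.lt_mul_div_succ p.1 hb
      simp [hP, h1, h2]
    · intro j _ hj
      have : ¬ (b * j.1 ≤ p.1 ∧ p.1 < b * (j.1 + 1)) := fun h => hj <| Fin.ext <| by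
        exact (Nat.div_eq_of_lt_le ((mul_comm _ _).trans_le h.1)
          (h.2.trans_eq (mul_comm _ _))).symm
      simp [hP, this]
    · simp
  have hEq : ∑ p : Fin (b * m), u p * (dot (A (π p)) (X (p.1 / b)) - dot (A (π p)) (X m))
      = (η / b) * ∑ j, dot (U j) (V j) := by
    calc _ = ∑ p : Fin (b * m), ∑ j : Fin m,
          P j p * (u p * (dot (A (π p)) (X j) - dot (A (π p)) (X m))) :=
          Finset.sum_congr rfl fun p _ =>
            hblock p fun i => u p * (dot (A (π p)) (X i) - dot (A (π p)) (X m))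
      _ = _ := by
          rw [Finset.sum_comm, Finset.mul_sum]
          refine Finset.sum_congr rfl fun j _ => ?_
          simp only [← dot_sub_right, hXV]
          simp only [hU, dot, Finset.mul_sum, Finset.sum_mul]
          rw [Finset.sum_comm]
          exact Finset.sum_congr rfl fun t _ => Finset.sum_congr rfl fun p _ => by ring
  have hbR : (0 : ℝ) < b := Nat.cast_pos.mpr hb
  have hmR : (0 : ℝ) < m := Nat.cast_pos.mpr hm
  have hy1 : ∀ p, |y p| ≤ 1 * G (π p) := fun p => by
    rw [one_mul]
    exact hgG _ _
  have hUle := sum_sq_mask_le_of_abs_le A G hG π P u hu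
  have hVle := sum_sq_mask_le_of_abs_le A G hG π Q y hy1
  have hUt : ∑ j, sq (U j) ≤ (b * tilC A (fun i => G i ^ 2) π) * (2 ^ 2 * ((b * m : ℕ) : ℝ)) := by
    refine hUle.trans_eq ?_
    congr 1
    rw [tilC, ← mul_assoc, mul_one_div_cancel hbR.ne', one_mul]
    rfl
  have hVt : ∑ j, sq (V j) ≤ (m * ((b * m : ℕ) : ℝ) * hatC A (fun i => G i ^ 2) π) *
      (1 ^ 2 * ((b * m : ℕ) : ℝ)) := by
    refine hVle.trans_eq ?_
    congr 1
    rw [hatC, ← mul_assoc, mul_one_div_cancel (by positivity), one_mul]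
    rfl
  rw [hEq]
  refine mul_le_mul_of_nonneg_left ?_ (by positivity)
  refine (sum_dot_le_sqrt_mul_sqrt U V).trans ?_
  have hU0 : 0 ≤ ∑ j, sq (U j) :=
    Finset.sum_nonneg fun j _ => Finset.sum_nonneg fun t _ => sq_nonneg _
  have hV0 : 0 ≤ ∑ j, sq (V j) :=
    Finset.sum_nonneg fun j _ => Finset.sum_nonneg fun t _ => sq_nonneg _
  rw [← Real.sqrt_mul hU0]
  calc √((∑ j, sq (U j)) * ∑ j, sq (V j))
      ≤ √((2 * ((b * m : ℕ) : ℝ) ^ 2) ^ 2 *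
          (hatC A (fun i => G i ^ 2) π * tilC A (fun i => G i ^ 2) π)) := by
        refine Real.sqrt_le_sqrt ((mul_le_mul hUt hVt hV0 (hU0.trans hUt)).trans_eq ?_)
        push_cast
        ring
    _ = _ := by
        rw [Real.sqrt_mul (by positivity), Real.sqrt_sq (by positivity)]

/-- One-epoch progress of shuffled SGD. -/
lemma epoch_bound (hb : 0 < b) (hm : 0 < m) (A : Matrix (Fin (b * m)) (Fin d) ℝ)
    (ℓ : Fin (b * m) → ℝ → ℝ) (G : Fin (b * m) → ℝ) (hG : ∀ i, 0 < G i)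
    (hLip : ∀ i s t, |ℓ i s - ℓ i t| ≤ G i * |s - t|)
    (g : Fin (b * m) → ℝ → ℝ) (hg : ∀ i t, IsSubgrad (ℓ i) t (g i t))
    {η : ℝ} (hη : 0 < η) (π : Equiv.Perm (Fin (b * m))) (x w : Fin d → ℝ) :
    η * ((1 / ((b * m : ℕ) : ℝ)) * ∑ i, ℓ i (dot (A i) (inIter A g η π x m))
        - (1 / ((b * m : ℕ) : ℝ)) * ∑ i, ℓ i (dot (A i) w)) ≤
      ((b : ℝ) / (2 * ((b * m : ℕ) : ℝ))) * (sq (fun t => x t - w t)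
        - sq (fun t => inIter A g η π x m t - w t))
      + 2 * η ^ 2 * ((b * m : ℕ) : ℝ) *
        √(hatC A (fun i => G i ^ 2) π * tilC A (fun i => G i ^ 2) π) / b := by
  set X := inIter A g η π x with hX
  set y := dualY A g η π x with hy
  have hgG : ∀ i t, |g i t| ≤ G i := fun i t => abs_le_of_isSubgrad (hLip i) (hg i t)
  set z : Fin (b * m) → ℝ := fun p => g (π p) (dot (A (π p)) (X m)) with hz
  have hdrift := sum_mul_dot_drift_le hb hm A g G hG hgG hη π x (fun p => y p - z p) fun p => by
    have h1 : |y p| ≤ G (π p) := hgG _ _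
    have h2 : |z p| ≤ G (π p) := hgG _ _
    exact (abs_sub _ _).trans (by linarith)
  rw [← hX] at hdrift
  have hbR : (0 : ℝ) < b := Nat.cast_pos.mpr hb
  have hn : (0 : ℝ) < ((b * m : ℕ) : ℝ) := Nat.cast_pos.mpr (Nat.mul_pos hb hm)
  have hgap : ∑ i, ℓ i (dot (A i) (X m)) - ∑ i, ℓ i (dot (A i) w) ≤
      ∑ p : Fin (b * m), (y p - z p) * (dot (A (π p)) (X (p.1 / b)) - dot (A (π p)) (X m))
      + ∑ p, y p * (dot (A (π p)) (X m) - dot (A (π p)) w) := by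
    rw [← Equiv.sum_comp π (fun i => ℓ i (dot (A i) (X m))),
      ← Equiv.sum_comp π (fun i => ℓ i (dot (A i) w)), ← Finset.sum_sub_distrib,
      ← Finset.sum_add_distrib]
    refine Finset.sum_le_sum fun p _ => ?_
    have h1 : ℓ (π p) (dot (A (π p)) (X (p.1 / b))) + y p *
        (dot (A (π p)) w - dot (A (π p)) (X (p.1 / b))) ≤ ℓ (π p) (dot (A (π p)) w) := hg _ _ _
    have h2 : ℓ (π p) (dot (A (π p)) (X m)) + z p *
        (dot (A (π p)) (X (p.1 / b)) - dot (A (π p)) (X m)) ≤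
        ℓ (π p) (dot (A (π p)) (X (p.1 / b))) := hg _ _ _
    linarith
  have hXm : ∀ t, x t - X m t = (η / b) * ∑ p, y p * A (π p) t := by
    intro t
    rw [hX, inIter_apply hb A g η π x t le_rfl, sub_sub_cancel]
    congr 1
    exact Finset.sum_congr rfl fun p _ => by rw [if_pos p.2, one_mul]
  have hprox : (η / b) * ∑ p, y p * (dot (A (π p)) (X m) - dot (A (π p)) w) ≤
      (1 / 2) * (sq (fun t => x t - w t) - sq (fun t => X m t - w t)) := by
    have heq : (η / b) * ∑ p, y p * (dot (A (π p)) (X m) - dot (A (π p)) w)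
        = ∑ t, (x t - X m t) * (X m t - w t) := by
      simp only [← dot_sub_right, hXm]
      simp only [dot, Finset.mul_sum, Finset.sum_mul]
      rw [Finset.sum_comm]
      exact Finset.sum_congr rfl fun t _ => Finset.sum_congr rfl fun p _ => by ring
    rw [heq, sq, sq, ← Finset.sum_sub_distrib, Finset.mul_sum]
    exact Finset.sum_le_sum fun t _ => by nlinarith [sq_nonneg (x t - X m t)]
  set S := √(hatC A (fun i => G i ^ 2) π * tilC A (fun i => G i ^ 2) π)
  set n : ℝ := ((b * m : ℕ) : ℝ)
  set D := ∑ p, y p * (dot (A (π p)) (X m) - dot (A (π p)) w)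
  have h1 := mul_le_mul_of_nonneg_left (hgap.trans (add_le_add_left hdrift D))
    (div_pos hη hn).le
  have h2 := mul_le_mul_of_nonneg_left hprox (div_pos hbR hn).le
  have e1 : η / n * (∑ i, ℓ i (dot (A i) (X m)) - ∑ i, ℓ i (dot (A i) w)) =
      η * (1 / n * ∑ i, ℓ i (dot (A i) (X m)) - 1 / n * ∑ i, ℓ i (dot (A i) w)) := by ring
  have e2 : b / n * (η / b * D) = η / n * D := by field_simp
  have e3 : η / n * (η / b * (2 * n ^ 2 * S)) = 2 * η ^ 2 * n * S / b := by field_simp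
  have e4 : ∀ q : ℝ, (b : ℝ) / n * (1 / 2 * q) = b / (2 * n) * q := fun q => by field_simp
  rw [e1, mul_add, e3] at h1
  rw [e2, e4] at h2
  linarith

/-- Jensen's inequality for the weighted average of iterates of a generalized linear model. -/
lemma sum_mul_le_of_convex {N : Type*} [Fintype N] (A : Matrix N (Fin d) ℝ) (ℓ : N → ℝ → ℝ)
    (hconv : ∀ i, ConvexOn ℝ Set.univ (ℓ i)) {κ : Type*} (s : Finset κ) (η : κ → ℝ)
    (hη : ∀ k ∈ s, 0 ≤ η k) (hs : 0 < ∑ k ∈ s, η k) (X : κ → Fin d → ℝ) :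
    (∑ k ∈ s, η k) * ∑ i, ℓ i (dot (A i) (fun t => (∑ k ∈ s, η k * X k t) / ∑ k ∈ s, η k)) ≤
      ∑ k ∈ s, η k * ∑ i, ℓ i (dot (A i) (X k)) := by
  set H := ∑ k ∈ s, η k
  simp only [Finset.mul_sum]
  rw [Finset.sum_comm]
  refine Finset.sum_le_sum fun i _ => ?_
  have hJ := (hconv i).map_sum_le (t := s) (w := fun k => η k / H)
    (p := fun k => dot (A i) (X k)) (fun k hk => div_nonneg (hη k hk) hs.le)
    (by rw [← Finset.sum_div, div_self hs.ne']) (fun _ _ => Set.mem_univ _)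
  simp only [smul_eq_mul] at hJ
  have hd : dot (A i) (fun t => (∑ k ∈ s, η k * X k t) / H)
      = ∑ k ∈ s, η k / H * dot (A i) (X k) := by
    rw [← dot_sum_right]
    congr 1
    funext t
    rw [Finset.sum_div]
    exact Finset.sum_congr rfl fun k _ => by ring
  rw [hd]
  refine (mul_le_mul_of_nonneg_left hJ hs.le).trans_eq ?_
  rw [Finset.mul_sum]
  exact Finset.sum_congr rfl fun k _ => by field_simp

/-- Convergence of shuffled SGD for an arbitrary sequence of permutations. -/
lemma shuffled_sgd_bound (hb : 0 < b) (hm : 0 < m) {K : ℕ} (hK : 0 < K)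
    (A : Matrix (Fin (b * m)) (Fin d) ℝ)
    (ℓ : Fin (b * m) → ℝ → ℝ) (G : Fin (b * m) → ℝ) (hG : ∀ i, 0 < G i)
    (hconv : ∀ i, ConvexOn ℝ Set.univ (ℓ i))
    (hLip : ∀ i s t, |ℓ i s - ℓ i t| ≤ G i * |s - t|)
    (g : Fin (b * m) → ℝ → ℝ) (hg : ∀ i t, IsSubgrad (ℓ i) t (g i t))
    (η : ℕ → ℝ) (hη : ∀ k, 0 < η k) (x0 w : Fin d → ℝ)
    (πs : ℕ → Equiv.Perm (Fin (b * m))) :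
    (∑ k ∈ Finset.range K, η k) * ((1 / ((b * m : ℕ) : ℝ)) * ∑ i, ℓ i (dot (A i)
        (fun t => (∑ k ∈ Finset.range K, η k * xSeq A g η πs x0 (k + 1) t) /
          ∑ k ∈ Finset.range K, η k))
        - (1 / ((b * m : ℕ) : ℝ)) * ∑ i, ℓ i (dot (A i) w)) ≤
      ((b : ℝ) / (2 * ((b * m : ℕ) : ℝ))) * sq (fun t => x0 t - w t)
      + ∑ k ∈ Finset.range K, 2 * η k ^ 2 * ((b * m : ℕ) : ℝ) *
        √(hatC A (fun i => G i ^ 2) (πs k) * tilC A (fun i => G i ^ 2) (πs k)) / b := by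
  have hH : 0 < ∑ k ∈ Finset.range K, η k :=
    Finset.sum_pos (fun k _ => hη k) (Finset.nonempty_range_iff.mpr hK.ne')
  have hJ := sum_mul_le_of_convex A ℓ hconv (Finset.range K) η (fun k _ => (hη k).le) hH
    (fun k => xSeq A g η πs x0 (k + 1))
  have hsum := Finset.sum_le_sum fun k (_ : k ∈ Finset.range K) =>
    epoch_bound hb hm A ℓ G hG hLip g hg (hη k) (πs k) (xSeq A g η πs x0 k) w
  rw [Finset.sum_add_distrib, ← Finset.mul_sum] at hsum
  have htel := Finset.sum_range_sub' (fun k => sq (fun t => xSeq A g η πs x0 k t - w t)) K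
  have hlast : 0 ≤ sq (fun t => xSeq A g η πs x0 K t - w t) :=
    Finset.sum_nonneg fun t _ => sq_nonneg _
  have hn : (0 : ℝ) < ((b * m : ℕ) : ℝ) := Nat.cast_pos.mpr (Nat.mul_pos hb hm)
  have hcoef : 0 ≤ (b : ℝ) / (2 * ((b * m : ℕ) : ℝ)) := by positivity
  have htel' : ((b : ℝ) / (2 * ((b * m : ℕ) : ℝ))) * ∑ k ∈ Finset.range K,
      (sq (fun t => xSeq A g η πs x0 k t - w t)
        - sq (fun t => inIter A g (η k) (πs k) (xSeq A g η πs x0 k) m t - w t)) ≤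
      ((b : ℝ) / (2 * ((b * m : ℕ) : ℝ))) * sq (fun t => x0 t - w t) := by
    refine mul_le_mul_of_nonneg_left ?_ hcoef
    refine htel.trans_le ?_
    simpa only [xSeq, sub_le_self_iff] using hlast
  refine le_trans ?_ (hsum.trans (add_le_add_left htel' _))
  have hJ' := mul_le_mul_of_nonneg_left hJ (one_div_pos.mpr hn).le
  simp only [mul_sub, Finset.sum_sub_distrib, ← Finset.sum_mul]
  refine sub_le_sub_right ?_ _
  rw [mul_left_comm]
  refine hJ'.trans_eq ?_
  rw [Finset.mul_sum]
  exact Finset.sum_congr rfl fun k _ => mul_left_comm _ _ _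

lemma Eunif_mono {α : Type*} [Fintype α] {F H : α → ℝ} (h : ∀ a, F a ≤ H a) :
    Eunif F ≤ Eunif H :=
  div_le_div_of_nonneg_right (Finset.sum_le_sum fun a _ => h a) (Nat.cast_nonneg _)

/-- The uniform expectation of an affine combination. -/
lemma Eunif_const_add_sum {α κ : Type*} [Fintype α] [Nonempty α] (c : ℝ) (s : Finset κ)
    (H : κ → α → ℝ) :
    Eunif (fun a => c + ∑ k ∈ s, H k a) = c + ∑ k ∈ s, Eunif (H k) := by
  have hcard : (Fintype.card α : ℝ) ≠ 0 := Nat.cast_ne_zero.mpr Fintype.card_ne_zero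
  simp only [Eunif, Finset.sum_add_distrib, Finset.sum_const, Finset.card_univ, nsmul_eq_mul]
  rw [add_div, mul_div_cancel_left₀ _ hcard, Finset.sum_comm, Finset.sum_div]

lemma Eunif_mul_div {α : Type*} [Fintype α] (c e : ℝ) (F : α → ℝ) :
    Eunif (fun a => c * F a / e) = c * Eunif F / e := by
  simp only [Eunif, ← Finset.sum_div, ← Finset.mul_sum]
  ring

/-- Each coordinate of a uniformly random tuple is uniformly distributed. -/
lemma Eunif_apply {α κ : Type*} [Fintype α] [Nonempty α] [Fintype κ] [DecidableEq κ] (k : κ)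
    (F : α → ℝ) : Eunif (fun f : κ → α => F (f k)) = Eunif F := by
  classical
  have h : ∑ f : κ → α, F (f k) =
      (Fintype.card ({j : κ // j ≠ k} → α) : ℝ) * ∑ a, F a := by
    rw [← Equiv.sum_comp (Equiv.funSplitAt k α).symm, Fintype.sum_prod_type]
    simp [Equiv.funSplitAt, Finset.mul_sum]
  have hcard : Fintype.card (κ → α) =
      Fintype.card α * Fintype.card ({j : κ // j ≠ k} → α) := by
    rw [Fintype.card_congr (Equiv.funSplitAt k α), Fintype.card_prod]
  have hne : (Fintype.card ({j : κ // j ≠ k} → α) : ℝ) ≠ 0 :=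
    Nat.cast_ne_zero.mpr Fintype.card_ne_zero
  rw [Eunif, Eunif, h, hcard, Nat.cast_mul, mul_comm (Fintype.card α : ℝ),
    mul_div_mul_left _ _ hne]

/-- **Theorem 3.3**: convergence of shuffled SGD for convex Lipschitz losses, for
random reshuffling, shuffle-once, and arbitrary fixed (deterministic) orderings. -/
theorem stmt8
    (b m d K : ℕ) (hb : 0 < b) (hm : 0 < m) (hK : 0 < K)
    (A : Matrix (Fin (b * m)) (Fin d) ℝ)
    (ℓ : Fin (b * m) → ℝ → ℝ) (G : Fin (b * m) → ℝ)
    (hG : ∀ i, 0 < G i)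
    (hconv : ∀ i, ConvexOn ℝ Set.univ (ℓ i))
    (hLip : ∀ i s t, |ℓ i s - ℓ i t| ≤ G i * |s - t|)
    (xstar : Fin d → ℝ)
    (hmin : ∀ x : Fin d → ℝ,
      (1 / ((b * m : ℕ) : ℝ)) * ∑ i, ℓ i (dot (A i) xstar)
        ≤ (1 / ((b * m : ℕ) : ℝ)) * ∑ i, ℓ i (dot (A i) x))
    (g : Fin (b * m) → ℝ → ℝ)
    (hg : ∀ i t, IsSubgrad (ℓ i) t (g i t))
    (η : ℕ → ℝ) (hη : ∀ k, 0 < η k)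
    (x0 : Fin d → ℝ) :
    let n : ℝ := ((b * m : ℕ) : ℝ)
    let f : (Fin d → ℝ) → ℝ := fun x => (1 / n) * ∑ i, ℓ i (dot (A i) x)
    let HK : ℝ := ∑ k ∈ Finset.range K, η k
    let val : (ℕ → Equiv.Perm (Fin (b * m))) → ℝ := fun πs =>
      HK * (f (fun t => (∑ k ∈ Finset.range K, η k * xSeq A g η πs x0 (k + 1) t) / HK)
              - f xstar)
    let Gbar : ℝ := Eunif (fun π : Equiv.Perm (Fin (b * m)) =>
      Real.sqrt (hatC A (fun i => (G i) ^ 2) π * tilC A (fun i => (G i) ^ 2) π))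
    let bnd : ℝ → ℝ := fun c => ((b : ℝ) / (2 * n)) * sq (fun t => x0 t - xstar t)
        + ∑ k ∈ Finset.range K, 2 * (η k) ^ 2 * n * c / (b : ℝ)
    (Eunif (fun gg : Fin K → Equiv.Perm (Fin (b * m)) => val (extSeq gg)) ≤ bnd Gbar)
    ∧ (Eunif (fun π0 : Equiv.Perm (Fin (b * m)) => val (fun _ => π0)) ≤ bnd Gbar)
    ∧ (∀ π0 : Equiv.Perm (Fin (b * m)), val (fun _ => π0)
        ≤ bnd (Real.sqrt (hatC A (fun i => (G i) ^ 2) π0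
                * tilC A (fun i => (G i) ^ 2) π0))) := by
  intro n f HK val Gbar bnd
  have hval := shuffled_sgd_bound hb hm hK A ℓ G hG hconv hLip g hg η hη x0 xstar
  refine ⟨?_, ?_, fun π0 => hval fun _ => π0⟩
  · refine (Eunif_mono fun gg => hval (extSeq gg)).trans_eq ?_
    rw [Eunif_const_add_sum]
    refine congrArg _ (Finset.sum_congr rfl fun k hk => ?_)
    rw [Eunif_mul_div]
    have hkK := Finset.mem_range.mp hk
    simp only [extSeq, dif_pos hkK]
    rw [Eunif_apply (⟨k, hkK⟩ : Fin K) fun π =>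
      √(hatC A (fun i => G i ^ 2) π * tilC A (fun i => G i ^ 2) π)]
  · refine (Eunif_mono fun π0 => hval fun _ => π0).trans_eq ?_
    rw [Eunif_const_add_sum]
    exact congrArg _ (Finset.sum_congr rfl fun k _ => Eunif_mul_div _ _ _)
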